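/- Let n ≥ 1 and t ≥ 2, and let π be a QU-resolution falsity proof of the mod-3 formula Ψₙ from the axiom set H(Ψₙ, Π_t). Then the label f of every sink of G(π) has at most one hole, i.e., the set {v : v ⪯ last(f)} ∖ dom(f) has at most one element. -/

import Mathlib

/-! Framework for quantified Boolean circuits (QBCs), QU-resolution,
relaxations, and the prover–delayer game, following Chen,
"Proof Complexity Modulo the Polynomial Hierarchy". -/

/-- Quantifiers. -/
inductive Quant where
  | all : Quant
  | ex : Quant
deriving DecidableEq

/-- A partial assignment of Boolean values to (numbered) propositional
variables.  Via the correspondence `C ↔ assign(C)`, partial assignments also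
represent clauses (the clause `clause(a)` is the unique clause with variable
set `dom a` falsified by `a`); we freely identify the two. -/
abbrev PA : Type := ℕ → Option Bool

/-- The everywhere-undefined partial assignment (= the empty clause). -/
def emptyPA : PA := fun _ => none

/-- `g` extends the partial assignment `f`. -/
def ExtendsPA (g f : PA) : Prop := ∀ v b, f v = some b → g v = some b

/-- A total assignment `g` extends a partial assignment `f`; when `f`
represents a clause, this says `g` falsifies that clause. -/
def TotalExtends (g : ℕ → Bool) (f : PA) : Prop := ∀ v b, f v = some b → g v = b

/-- A partial assignment `r` satisfies a clause `C` (i.e. makes some literal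
of `C` true). -/
def SatisfiedBy (r : PA) (C : PA) : Prop := ∃ v b, C v = some b ∧ r v = some (!b)

/-- A quantified Boolean circuit: a quantifier prefix (a list of
quantifier/variable pairs) together with a Boolean function on total
assignments, represented as a predicate. -/
structure QBC where
  pfx : List (Quant × ℕ)
  matrix : (ℕ → Bool) → Prop

/-- The variables of the prefix of a QBC. -/
def QBC.vars (Φ : QBC) : List ℕ := Φ.pfx.map Prod.snd

/-- Well-formedness of a QBC: the prefix has no repeated variables, and the
matrix depends only on the values of the prefix variables. -/
def QBC.WellFormed (Φ : QBC) : Prop :=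
  Φ.vars.Nodup ∧
  ∀ f g : ℕ → Bool, (∀ v ∈ Φ.vars, f v = g v) → (Φ.matrix f ↔ Φ.matrix g)

/-- Standard semantics of a quantifier prefix over a matrix, starting from a
base assignment. -/
def evalQ : List (Quant × ℕ) → ((ℕ → Bool) → Prop) → (ℕ → Bool) → Prop
  | [], φ, g => φ g
  | (Quant.ex, v) :: P, φ, g => ∃ b, evalQ P φ (Function.update g v b)
  | (Quant.all, v) :: P, φ, g => ∀ b, evalQ P φ (Function.update g v b)

/-- Truth of a QBC. -/
def QBC.IsTrue (Φ : QBC) : Prop := ∀ g, evalQ Φ.pfx Φ.matrix g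

/-- Falsity of a QBC. -/
def QBC.IsFalse (Φ : QBC) : Prop := ¬ Φ.IsTrue

/-- The existentially quantified variables of a prefix. -/
def existVars (P : List (Quant × ℕ)) : List ℕ :=
  (P.filter fun p => decide (p.1 = Quant.ex)).map Prod.snd

/-- The universally quantified variables of a prefix. -/
def univVars (P : List (Quant × ℕ)) : List ℕ :=
  (P.filter fun p => decide (p.1 = Quant.all)).map Prod.snd

/-- The relation `u ⪯ v` of a prefix: `vᵢ ⪯ vⱼ` iff `i ≤ j`, or `j < i` and
`Qⱼ = Qⱼ₊₁ = ⋯ = Qᵢ`. -/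
def preceq (P : List (Quant × ℕ)) (u v : ℕ) : Prop :=
  ∃ i j : ℕ, (P[i]?).map Prod.snd = some u ∧ (P[j]?).map Prod.snd = some v ∧
    (i ≤ j ∨ (j < i ∧ ∀ k, j ≤ k → k ≤ i → (P[k]?).map Prod.fst = (P[j]?).map Prod.fst))

/-- `u` strictly precedes `v` (`u ⪯ v` and not `v ⪯ u`). -/
def strictPrec (P : List (Quant × ℕ)) (u v : ℕ) : Prop :=
  preceq P u v ∧ ¬ preceq P v u

/-- dom(f) ⪯ y : every variable on which `f` is defined is `⪯ y`. -/
def domPrec (P : List (Quant × ℕ)) (f : PA) (y : ℕ) : Prop :=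
  ∀ u, f u ≠ none → preceq P u y

/-- An ∃-strategy: a family of response functions for the existential
variables, each depending only on the universal variables strictly
preceding it. -/
def IsExStrategy (Φ : QBC) (σ : ℕ → (ℕ → Bool) → Bool) : Prop :=
  ∀ x ∈ existVars Φ.pfx, ∀ τ τ' : ℕ → Bool,
    (∀ y ∈ univVars Φ.pfx, strictPrec Φ.pfx y x → τ y = τ' y) → σ x τ = σ x τ'

/-- The total assignment `⟨σ, τ⟩` induced by an ∃-strategy `σ` and an
assignment `τ` to the universal variables. -/
def playE (Φ : QBC) (σ : ℕ → (ℕ → Bool) → Bool) (τ : ℕ → Bool) : ℕ → Bool :=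
  fun v => if v ∈ existVars Φ.pfx then σ v τ else τ v

/-- `σ` is a winning ∃-strategy of the prefix of `Φ` for the matrix `M`. -/
def ModelOf (Φ : QBC) (M : (ℕ → Bool) → Prop) (σ : ℕ → (ℕ → Bool) → Bool) : Prop :=
  IsExStrategy Φ σ ∧ ∀ τ : ℕ → Bool, M (playE Φ σ τ)

/-- A model of `Φ` (a winning ∃-strategy). -/
def QBC.Model (Φ : QBC) (σ : ℕ → (ℕ → Bool) → Bool) : Prop :=
  ModelOf Φ Φ.matrix σ

/-- `σ` is a model of `P : C`, where `P` is the prefix of `Φ` and `C` is a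
clause (represented by its falsifying assignment). -/
def ModelOfClause (Φ : QBC) (σ : ℕ → (ℕ → Bool) → Bool) (C : PA) : Prop :=
  ModelOf Φ (fun g => ¬ TotalExtends g C) σ

/-- `C` is an axiom of `Φ`: a clause on the variables of `Φ` such that every
model of `Φ` is a model of `P : C`. -/
def IsAxiom (Φ : QBC) (C : PA) : Prop :=
  (∀ v, C v ≠ none → v ∈ Φ.vars) ∧ ∀ σ, Φ.Model σ → ModelOfClause Φ σ C

/-- An axiom set of `Φ`. -/
def IsAxiomSet (Φ : QBC) (H : Set PA) : Prop := ∀ C ∈ H, IsAxiom Φ C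

/-- A ∀-strategy: response functions for the universal variables, each
depending only on the existential variables strictly preceding it. -/
def IsUnivStrategy (Φ : QBC) (τ : ℕ → (ℕ → Bool) → Bool) : Prop :=
  ∀ y ∈ univVars Φ.pfx, ∀ σ σ' : ℕ → Bool,
    (∀ x ∈ existVars Φ.pfx, strictPrec Φ.pfx x y → σ x = σ' x) → τ y σ = τ y σ'

/-- The total assignment `⟨τ, σ⟩` induced by a ∀-strategy `τ` and an
assignment `σ` to the existential variables. -/
def playU (Φ : QBC) (τ : ℕ → (ℕ → Bool) → Bool) (σ : ℕ → Bool) : ℕ → Bool :=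
  fun v => if v ∈ univVars Φ.pfx then τ v σ else σ v

/-- A winning ∀-strategy: every play falsifies the matrix. -/
def WinningUnivStrategy (Φ : QBC) (τ : ℕ → (ℕ → Bool) → Bool) : Prop :=
  IsUnivStrategy Φ τ ∧ ∀ σ : ℕ → Bool, ¬ Φ.matrix (playU Φ τ σ)

/-- `C` is obtainable from `D` by ∀-elimination (relative to prefix `P`):
`C = D ∖ {L}` for a literal `L` on a universal variable `y` with
`vars(C) ⪯ y`.  In assignment form: `D` is `C` additionally defined on `y`. -/
def ForallElim (P : List (Quant × ℕ)) (C D : PA) : Prop :=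
  ∃ y b, y ∈ univVars P ∧ C y = none ∧ D = Function.update C y (some b) ∧
    ∀ u, C u ≠ none → preceq P u y

/-- `γ` is the resolvent of `α` and `β` on variable `v` (in falsifying
assignment form: `α` and `β` carry complementary literals on `v`, `γ` is
the union of the remainders, which must be a clause). -/
def IsResolvent (γ α β : PA) (v : ℕ) : Prop :=
  ∃ b, α v = some b ∧ β v = some (!b) ∧ γ v = none ∧
    (∀ u, u ≠ v → γ u = (α u).elim (β u) some) ∧
    (∀ u, u ≠ v → ∀ b₁ b₂, α u = some b₁ → β u = some b₂ → b₁ = b₂)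

/-- A step in a QU-resolution proof: an axiom, a ∀-elimination (annotated with
the index of its source), or a resolution step (annotated with the indices of
its two sources and the resolved variable). -/
inductive QUStep where
  | ax (C : PA)
  | elim (C : PA) (src : ℕ)
  | res (C : PA) (src₁ src₂ : ℕ) (v : ℕ)

/-- The clause of a proof step. -/
def QUStep.clause : QUStep → PA
  | .ax C => C
  | .elim C _ => C
  | .res C _ _ _ => C

/-- The clause at position `i` of a proof. -/
def stepClause? (L : List QUStep) (i : ℕ) : Option PA := (L[i]?).map QUStep.clause

/-- Validity of the `i`-th step of a proof from axiom set `H`. -/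
def validStep (P : List (Quant × ℕ)) (H : Set PA) (L : List QUStep) (i : ℕ) : Prop :=
  match L[i]? with
  | none => True
  | some (.ax C) => C ∈ H
  | some (.elim C j) => j < i ∧ ∃ D, stepClause? L j = some D ∧ ForallElim P C D
  | some (.res C j k v) => j < i ∧ k < i ∧
      ∃ α β, stepClause? L j = some α ∧ stepClause? L k = some β ∧ IsResolvent C α β v

/-- A QU-resolution proof of `Φ` from axiom set `H`. -/
def IsQUProof (Φ : QBC) (H : Set PA) (L : List QUStep) : Prop :=
  ∀ i, validStep Φ.pfx H L i

/-- A QU-resolution falsity proof: a proof ending with the empty clause. -/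
def IsFalsityProof (Φ : QBC) (H : Set PA) (L : List QUStep) : Prop :=
  IsQUProof Φ H L ∧ (L.getLast?).map QUStep.clause = some emptyPA

/-- The clause `C` appears in the proof `L`. -/
def AppearsIn (L : List QUStep) (C : PA) : Prop := ∃ i, stepClause? L i = some C

/-- The edge relation of the graph `G(π)`: an edge from each clause occurrence
to the clause occurrence(s) from which it is derived. -/
def edge (L : List QUStep) (i j : ℕ) : Prop :=
  match L[i]? with
  | some (.elim _ s) => j = s
  | some (.res _ s t _) => j = s ∨ j = t
  | _ => False

/-- A sink (leaf) of `G(π)`: a vertex with no outgoing edges. -/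
def isSink (L : List QUStep) (i : ℕ) : Prop := i < L.length ∧ ∀ j, ¬ edge L i j

/-- The proof is tree-like: `G(π)` is a tree (each vertex has at most one
incoming edge; acyclicity holds automatically since edges decrease indices). -/
def TreeLike (L : List QUStep) : Prop := ∀ j : ℕ, {i | edge L i j}.Subsingleton

-- The prefix `P[a]`: the variables of `dom a` are removed, and the
-- quantifier of every variable strictly preceding some variable of `dom a`
-- (equivalently, every `v` with `v ⪯ last(a)` and not `last(a) ⪯ v`) is
-- changed to `∃`.
open Classical in
noncomputable def instPrefix (P : List (Quant × ℕ)) (a : PA) : List (Quant × ℕ) :=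
  (P.filter fun p => (a p.2).isNone).map fun p =>
    (if ∃ u, a u ≠ none ∧ strictPrec P p.2 u then Quant.ex else p.1, p.2)

/-- Overriding a total assignment by a partial assignment. -/
def override (a : PA) (g : ℕ → Bool) : ℕ → Bool := fun v => (a v).getD (g v)

/-- The instantiated QBC `Φ[a]` = `P[a] : φ[a]`. -/
noncomputable def QBC.inst (Φ : QBC) (a : PA) : QBC :=
  ⟨instPrefix Φ.pfx a, fun g => Φ.matrix (override a g)⟩

/-- `P'` is a relaxation of the prefix `P`: a permutation of `P` such that
`y ⪯ x` implies `y ⪯' x` for every universal `y` and existential `x`. -/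
def IsRelaxationPfx (P P' : List (Quant × ℕ)) : Prop :=
  P.Perm P' ∧ ∀ y ∈ univVars P, ∀ x ∈ existVars P, preceq P y x → preceq P' y x

/-- `Φ'` is a relaxation of the QBC `Φ`. -/
def IsRelaxation (Φ Φ' : QBC) : Prop :=
  IsRelaxationPfx Φ.pfx Φ'.pfx ∧ Φ'.matrix = Φ.matrix

/-- Negation of a quantifier. -/
def Quant.neg : Quant → Quant
  | .all => .ex
  | .ex => .all

/-- `isAltFrom q i qs`: the quantifier string `qs` consists of (at most) `i`
alternating possibly-empty blocks, starting with a block of `q`s. -/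
def isAltFrom : Quant → ℕ → List Quant → Prop
  | _, 0, qs => qs = []
  | q, i + 1, qs => ∃ k rest, qs = List.replicate k q ++ rest ∧ isAltFrom q.neg i rest

/-- The prefix `P` is `Π_i`: its quantifier string lies in `∀*∃*∀*⋯` with `i`
alternating starred blocks beginning with `∀*`. -/
def isPiPrefix (i : ℕ) (P : List (Quant × ℕ)) : Prop :=
  isAltFrom Quant.all i (P.map Prod.fst)

/-- The axiom set `H(Φ, Π_k)`: the clauses `C` on variables of `Φ` such that
some `Π_k`-relaxation of `Φ[assign(C)]` is false. -/
def Hset (Φ : QBC) (k : ℕ) : Set PA :=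
  {C | (∀ v, C v ≠ none → v ∈ Φ.vars) ∧
    ∃ Φ' : QBC, IsRelaxation (Φ.inst C) Φ' ∧ isPiPrefix k Φ'.pfx ∧ Φ'.IsFalse}

/-- `g` is a semicompletion of `f` (relative to prefix `P`). -/
def SemiComp (P : List (Quant × ℕ)) (f g : PA) : Prop :=
  ExtendsPA g f ∧
  ∀ y ∈ univVars P, f y = none → domPrec P f y → (g y = none ∧ domPrec P g y)

/-- A set of partial assignments of `Φ` is semicompletion-closed. -/
def SemiCompClosed (Φ : QBC) (H : Set PA) : Prop :=
  ∀ f ∈ H, ∀ g : PA, (∀ v, g v ≠ none → v ∈ Φ.vars) → SemiComp Φ.pfx f g → g ∈ H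

/-- Delayer condition (semicompletion-of-empty). -/
def CondEmpty (Φ : QBC) (F : Set PA) (s : PA → ℕ) : Prop :=
  ∃ g ∈ F, SemiComp Φ.pfx emptyPA g ∧ s g = 0

/-- Delayer condition (monotonicity). -/
def CondMono (Φ : QBC) (F : Set PA) (s : PA → ℕ) : Prop :=
  ∀ g ∈ F, ∀ f' : PA, ExtendsPA g f' → ∃ f ∈ F, SemiComp Φ.pfx f' f ∧ s f ≤ s g

/-- Delayer condition (∀-branching). -/
def CondForallB (Φ : QBC) (F : Set PA) (s : PA → ℕ) : Prop :=
  ∀ f ∈ F, ∀ y ∈ univVars Φ.pfx, f y = none → domPrec Φ.pfx f y →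
    ∀ b : Bool, ∃ g ∈ F, SemiComp Φ.pfx (Function.update f y (some b)) g ∧ s g = s f

/-- Delayer condition (double-branching). -/
def CondDoubleB (Φ : QBC) (F : Set PA) (s : PA → ℕ) : Prop :=
  ∀ f ∈ F, ∀ v ∈ Φ.vars, f v = none →
    ∃ b : Bool, ∃ g ∈ F, SemiComp Φ.pfx (Function.update f v (some b)) g ∧
      s g ≤ s f + 1 ∧
      (s g = s f + 1 →
        ∃ g' ∈ F, SemiComp Φ.pfx (Function.update f v (some (!b))) g' ∧ s g' ≤ s f + 1)

/-- A `p`-point delayer strategy for `Φ` with respect to axiom set `H`. -/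
def IsDelayer (Φ : QBC) (H : Set PA) (p : ℕ) (F : Set PA) (s : PA → ℕ) : Prop :=
  (∀ f ∈ F, ∀ v, f v ≠ none → v ∈ Φ.vars) ∧
  CondEmpty Φ F s ∧ (∀ f ∈ F, f ∈ H → p ≤ s f) ∧
  CondMono Φ F s ∧ CondForallB Φ F s ∧ CondDoubleB Φ F s

/-! The separation formulas `Φₙ` of Section 6. -/

/-- The variable `x_{i,j,k}`. -/
def xV (i : ℕ) (j k : Bool) : ℕ := 9 * i + 2 * cond j 1 0 + cond k 1 0

/-- The variable `x'_{i,j,k}`. -/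
def xV' (i : ℕ) (j k : Bool) : ℕ := 9 * i + 4 + 2 * cond j 1 0 + cond k 1 0

/-- The variable `yᵢ`. -/
def yV (i : ℕ) : ℕ := 9 * i + 8

/-- A block of four quantified variables. -/
def blockOf (q : Quant) (f : Bool → Bool → ℕ) : List (Quant × ℕ) :=
  [(q, f false false), (q, f false true), (q, f true false), (q, f true true)]

/-- The prefix `∃X₀ ∃X'₁∀y₁∃X₁ ⋯ ∃X'ₙ∀yₙ∃Xₙ`. -/
def sepPrefix (n : ℕ) : List (Quant × ℕ) :=
  blockOf Quant.ex (xV 0) ++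
    (List.range n).flatMap fun i =>
      blockOf Quant.ex (xV' (i + 1)) ++ [(Quant.all, yV (i + 1))] ++
        blockOf Quant.ex (xV (i + 1))

/-- The clause `¬x_{0,j,k}` (as its falsifying assignment). -/
def clB1 (j k : Bool) : PA := fun v => if v = xV 0 j k then some true else none

/-- The clause `x_{n,j,0} ∨ x_{n,j,1}`. -/
def clB2 (n : ℕ) (j : Bool) : PA :=
  fun v => if v = xV n j false ∨ v = xV n j true then some false else none

/-- The clause `¬x'_{i,0,k} ∨ ¬x'_{i,1,l} ∨ x_{i−1,j,0} ∨ x_{i−1,j,1}`. -/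
def clH (i : ℕ) (j k l : Bool) : PA := fun v =>
  if v = xV' i false k ∨ v = xV' i true l then some true
  else if v = xV (i - 1) j false ∨ v = xV (i - 1) j true then some false
  else none

/-- For `j = false` the clause `¬x_{i,0,k} ∨ yᵢ ∨ x'_{i,0,k}`; for `j = true`
the clause `¬x_{i,1,k} ∨ ¬yᵢ ∨ x'_{i,1,k}`. -/
def clT (i : ℕ) (j k : Bool) : PA := fun v =>
  if v = xV i j k then some true
  else if v = yV i then some j
  else if v = xV' i j k then some false
  else none

/-- The set `Tᵢ` of clauses. -/
def Tset (i : ℕ) : Set PA := {C | ∃ j k : Bool, C = clT i j k}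

/-- The set of clauses of the matrix `φₙ`. -/
def sepClauses (n : ℕ) : Set PA :=
  {C | (∃ j k : Bool, C = clB1 j k) ∨ (∃ j : Bool, C = clB2 n j) ∨
    (∃ i, 1 ≤ i ∧ i ≤ n ∧ ∃ j k l : Bool, C = clH i j k l) ∨
    (∃ i, 1 ≤ i ∧ i ≤ n ∧ ∃ j k : Bool, C = clT i j k)}

/-- The separation formula `Φₙ`. -/
def sepQBC (n : ℕ) : QBC :=
  ⟨sepPrefix n, fun g => ∀ C ∈ sepClauses n, ¬ TotalExtends g C⟩

/-- The level-`i` variables `X'ᵢ ∪ {yᵢ} ∪ Xᵢ`. -/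
def levelVars (i : ℕ) : List ℕ :=
  [xV' i false false, xV' i false true, xV' i true false, xV' i true true, yV i,
   xV i false false, xV i false true, xV i true false, xV i true true]

/-- `r` is defined exactly on the level-`i` variables. -/
def OnLevel (i : ℕ) (r : PA) : Prop := ∀ v, r v ≠ none ↔ v ∈ levelVars i

/-- A normal realization of level `i`. -/
def NormalReal (i : ℕ) (r : PA) : Prop :=
  OnLevel i r ∧ ∃ b : Bool, r (yV i) = some b ∧
    r (xV i b false) = some false ∧ r (xV' i b false) = some false ∧
    r (xV i b true) = some false ∧ r (xV' i b true) = some false ∧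
    ∃ c : Bool, r (xV i (!b) false) = some c ∧ r (xV' i (!b) false) = some c ∧
      r (xV i (!b) true) = some (!c) ∧ r (xV' i (!b) true) = some (!c)

/-- A funny realization of level `i`. -/
def FunnyReal (i : ℕ) (r : PA) : Prop :=
  OnLevel i r ∧ ∃ b : Bool, r (yV i) = some b ∧
    (∃ c : Bool, r (xV i b false) = some c ∧ r (xV' i b false) = some c ∧
      r (xV i b true) = some (!c) ∧ r (xV' i b true) = some (!c)) ∧
    r (xV' i (!b) false) = some false ∧ r (xV' i (!b) true) = some false ∧
    ∃ d : Bool, r (xV i (!b) false) = some d ∧ r (xV i (!b) true) = some (!d)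

/-- Restriction of a partial assignment to the level-`i` variables. -/
def restrictLevel (i : ℕ) (f : PA) : PA :=
  fun v => if v ∈ levelVars i then f v else none

-- The maximum level `ℓ` containing an existentially quantified variable of
-- `dom f` (and `0` if there is none).
open Classical in
noncomputable def maxLevel (n : ℕ) (f : PA) : ℕ :=
  ((Finset.Icc 1 n).filter fun i => ∃ v ∈ levelVars i, v ≠ yV i ∧ f v ≠ none).sup id

/-- `f` is half-defined on level `ℓ`. -/
def HalfDefined (ℓ : ℕ) (f : PA) : Prop :=
  (∀ j k : Bool, f (xV ℓ j k) = none) ∧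
  (∃ j k : Bool, f (xV' ℓ j k) = some true ∧
    ∀ j' k' : Bool, (j', k') ≠ (j, k) → f (xV' ℓ j' k') = some false)

/-- A normal assignment of `Φₙ`. -/
def NormalAssign (n : ℕ) (f : PA) : Prop :=
  (∀ v, f v ≠ none → v ∈ (sepPrefix n).map Prod.snd) ∧
  (∀ j k : Bool, f (xV 0 j k) = some false) ∧
  (∀ i, 1 ≤ i → i + 1 ≤ maxLevel n f → NormalReal i (restrictLevel i f)) ∧
  (1 ≤ maxLevel n f →
    (NormalReal (maxLevel n f) (restrictLevel (maxLevel n f) f) ∨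
      HalfDefined (maxLevel n f) f))

/-- A funny assignment of `Φₙ`, with witness `m` (so that `sₙ(f) = m`). -/
def FunnyAssign (n : ℕ) (f : PA) (m : ℕ) : Prop :=
  (∀ v, f v ≠ none → v ∈ (sepPrefix n).map Prod.snd) ∧
  1 ≤ m ∧ m ≤ maxLevel n f ∧
  (∀ j k : Bool, f (xV 0 j k) = some false) ∧
  (∀ i, 1 ≤ i → i < m → NormalReal i (restrictLevel i f)) ∧
  FunnyReal m (restrictLevel m f) ∧
  (∀ i, m < i → i ≤ maxLevel n f → ∀ j : Bool,
    ((f (xV i j false) ≠ none ∨ f (xV i j true) ≠ none ∨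
      f (xV' i j false) ≠ none ∨ f (xV' i j true) ≠ none) →
      ∃ c : Bool, f (xV i j false) = some c ∧ f (xV' i j false) = some c ∧
        f (xV i j true) = some (!c) ∧ f (xV' i j true) = some (!c)))

/-- The set `Fₙ` of normal and funny assignments. -/
def Fset (n : ℕ) : Set PA := {f | NormalAssign n f ∨ ∃ m, FunnyAssign n f m}

-- The score function `sₙ`.
open Classical in
noncomputable def score (n : ℕ) (f : PA) : ℕ :=
  if h : ∃ m, FunnyAssign n f m then h.choose else maxLevel n f

/-! The mod-3 formulas `Ψₙ` of Section 7 (variables `xᵢ = 2i`, `yᵢ = 2i+1`). -/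

/-- The prefix `∃x₁∀y₁⋯∃xₙ∀yₙ`. -/
def modPrefix (n : ℕ) : List (Quant × ℕ) :=
  (List.range n).flatMap fun i =>
    [(Quant.ex, 2 * (i + 1)), (Quant.all, 2 * (i + 1) + 1)]

/-- Numeric value of a Boolean. -/
def boolVal (b : Bool) : ℕ := cond b 1 0

/-- The matrix `φ_{n,j}`: true iff `j + Σᵢ (xᵢ + yᵢ) ≢ n (mod 3)`. -/
def modMatrix (n j : ℕ) (g : ℕ → Bool) : Prop :=
  ¬ ((j + ∑ i ∈ Finset.Icc 1 n, (boolVal (g (2 * i)) + boolVal (g (2 * i + 1)))) % 3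
      = n % 3)

/-- The mod-3 formula `Ψₙ`. -/
def modQBC (n : ℕ) : QBC := ⟨modPrefix n, modMatrix n 0⟩

theorem evalQ_of_strategy (E : List ℕ) (σ : ℕ → (ℕ → Bool) → Bool) (φ : (ℕ → Bool) → Prop)
    (hφ : ∀ τ, φ (fun v => if v ∈ E then σ v τ else τ v)) :
    ∀ (R : List (Quant × ℕ)) (g : ℕ → Bool), (R.map Prod.snd).Nodup →
    (∀ v, (Quant.ex, v) ∈ R → v ∈ E) → (∀ v, (Quant.all, v) ∈ R → v ∉ E) →
    (∀ A B x, R = A ++ (Quant.ex, x) :: B → ∀ τ τ' : ℕ → Bool,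
      (∀ u, u ∉ E → u ∉ B.map Prod.snd → τ u = τ' u) → σ x τ = σ x τ') →
    (∀ τ : ℕ → Bool, (∀ u, u ∉ E → u ∉ R.map Prod.snd → τ u = g u) →
      ∀ v, v ∉ R.map Prod.snd → (if v ∈ E then σ v τ else τ v) = g v) →
    evalQ R φ g := by
  intro R
  induction R with
  | nil =>
    intro g _ _ _ _ h
    have := hφ g
    have e : (fun v => if v ∈ E then σ v g else g v) = g := by
      funext v
      exact h g (fun _ _ _ => rfl) v (by simp)
    rw [e] at this
    exact this
  | cons p R ih =>
    obtain ⟨q, w⟩ := p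
    intro g hnd hE hA hdep hinv
    simp only [List.map_cons, List.nodup_cons] at hnd
    have hdep' : ∀ A B x, R = A ++ (Quant.ex, x) :: B → ∀ τ τ' : ℕ → Bool,
      (∀ u, u ∉ E → u ∉ B.map Prod.snd → τ u = τ' u) → σ x τ = σ x τ' := by
      intro A B x hR
      exact hdep ((q, w) :: A) B x (by simp [hR])
    have hE' : ∀ v, (Quant.ex, v) ∈ R → v ∈ E := fun v hv => hE v (List.mem_cons_of_mem _ hv)
    have hA' : ∀ v, (Quant.all, v) ∈ R → v ∉ E := fun v hv => hA v (List.mem_cons_of_mem _ hv)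
    cases q with
    | all =>
      have hw : w ∉ E := hA w (by simp)
      intro b
      apply ih _ hnd.2 hE' hA' hdep'
      intro τ hτ v hv
      by_cases hvw : v = w
      · subst hvw
        rw [if_neg hw]
        exact hτ v hw hv
      · rw [Function.update_of_ne hvw]
        apply hinv τ
        · intro u hu hu2
          simp only [List.map_cons, List.mem_cons, not_or] at hu2
          rw [hτ u hu hu2.2, Function.update_of_ne hu2.1]
        · simp only [List.map_cons, List.mem_cons, not_or]
          exact ⟨hvw, hv⟩
    | ex =>
      have hw : w ∈ E := hE w (by simp)
      refine ⟨σ w g, ?_⟩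
      apply ih _ hnd.2 hE' hA' hdep'
      intro τ hτ v hv
      have hτ' : ∀ u, u ∉ E → u ∉ R.map Prod.snd → τ u = g u := by
        intro u hu hu2
        rw [hτ u hu hu2, Function.update_of_ne]
        rintro rfl
        exact hu hw
      by_cases hvw : v = w
      · subst hvw
        rw [if_pos hw, Function.update_self]
        exact hdep [] R v rfl _ _ hτ'
      · rw [Function.update_of_ne hvw]
        apply hinv τ
        · intro u hu hu2
          simp only [List.map_cons, List.mem_cons, not_or] at hu2
          exact hτ' u hu hu2.2
        · simp only [List.map_cons, List.mem_cons, not_or]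
          exact ⟨hvw, hv⟩

theorem mem_existVars' (P : List (Quant × ℕ)) (v : ℕ) :
    v ∈ existVars P ↔ (Quant.ex, v) ∈ P := by
  simp [existVars]

theorem mem_univVars' (P : List (Quant × ℕ)) (v : ℕ) :
    v ∈ univVars P ↔ (Quant.all, v) ∈ P := by
  simp [univVars]

/-- Strategies transfer to relaxations. -/
theorem evalQ_relaxation (P P' : List (Quant × ℕ)) (hrel : IsRelaxationPfx P P')
    (hnd : (P.map Prod.snd).Nodup) (σ : ℕ → (ℕ → Bool) → Bool) (φ : (ℕ → Bool) → Prop)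
    (hσ : ∀ x, (Quant.ex, x) ∈ P → ∀ τ τ' : ℕ → Bool,
      (∀ u, (Quant.all, u) ∈ P → preceq P u x → τ u = τ' u) → σ x τ = σ x τ')
    (hφ : ∀ τ, φ (fun v => if v ∈ existVars P then σ v τ else τ v)) (g : ℕ → Bool) :
    evalQ P' φ g := by
  obtain ⟨hperm, hpre⟩ := hrel
  have hnd' : (P'.map Prod.snd).Nodup := (hperm.map Prod.snd).nodup_iff.1 hnd
  have hAE : ∀ v, (Quant.all, v) ∈ P → v ∉ existVars P := by
    intro v hv hv'
    rw [mem_existVars'] at hv'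
    have := List.inj_on_of_nodup_map hnd hv hv' rfl
    simp at this
  apply evalQ_of_strategy (existVars P) σ φ hφ P' g hnd'
  · intro v hv
    rw [mem_existVars']
    exact hperm.mem_iff.2 hv
  · intro v hv
    exact hAE v (hperm.mem_iff.2 hv)
  · intro A B x hP' τ τ' h
    have hx : (Quant.ex, x) ∈ P := hperm.mem_iff.2 (by rw [hP']; simp)
    apply hσ x hx
    intro u hu hux
    apply h u (hAE u hu)
    have hux' := hpre u ((mem_univVars' _ _).2 hu) x ((mem_existVars' _ _).2 hx) hux
    obtain ⟨i, j, hi, hj, hij⟩ := hux'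
    intro huB
    have hlt : ∀ i v, (P'[i]?).map Prod.snd = some v →
        ∃ h : i < (P'.map Prod.snd).length, (P'.map Prod.snd)[i] = v := by
      intro i v hv
      rw [← List.getElem?_map] at hv
      exact List.getElem?_eq_some_iff.1 hv
    obtain ⟨hi1, hi2⟩ := hlt i u hi
    obtain ⟨hj1, hj2⟩ := hlt j x hj
    have hxA : (P'[A.length]?).map Prod.snd = some x := by
      rw [hP']; simp
    obtain ⟨ha1, ha2⟩ := hlt _ x hxA
    have hjA : j = A.length := (List.Nodup.getElem_inj_iff hnd').1 (hj2.trans ha2.symm)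
    obtain ⟨k, hk, hk2⟩ := List.mem_iff_getElem.1 huB
    have huk : (P'[A.length + 1 + k]?).map Prod.snd = some u := by
      rw [hP', ← hk2]
      simp only [List.length_map] at hk
      rw [List.getElem?_append_right (by omega)]
      have : A.length + 1 + k - A.length = k + 1 := by omega
      rw [this, List.getElem?_cons_succ]
      simp [hk]
    obtain ⟨hu1, hu2⟩ := hlt _ u huk
    have hik : i = A.length + 1 + k := (List.Nodup.getElem_inj_iff hnd').1 (hi2.trans hu2.symm)
    rcases hij with hij | ⟨hij, hq⟩
    · omega
    · have hq' := hq i hij.le le_rfl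
      simp only [List.length_map] at hi1 hj1
      simp only [List.getElem_map] at hi2 hj2
      rw [List.getElem?_eq_getElem hi1, List.getElem?_eq_getElem hj1] at hq'
      simp only [Option.map_some, Option.some.injEq] at hq'
      have m1 : P'[i] = (Quant.all, u) := List.inj_on_of_nodup_map hnd' (List.getElem_mem hi1)
        (hperm.mem_iff.1 hu) hi2
      have m2 : P'[j] = (Quant.ex, x) := List.inj_on_of_nodup_map hnd' (List.getElem_mem hj1)
        (hperm.mem_iff.1 hx) hj2
      rw [m1, m2] at hq'
      simp at hq'
  · intro τ hτ v hv
    have hvE : v ∉ existVars P := by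
      rw [mem_existVars']
      intro hv'
      exact hv (List.mem_map.2 ⟨_, hperm.mem_iff.1 hv', rfl⟩)
    rw [if_neg hvE]
    exact hτ v hvE hv

/-- Quantifier of a variable in the mod-3 prefix, by parity. -/
def parQ (v : ℕ) : Quant := if v % 2 = 0 then Quant.ex else Quant.all

theorem modPrefix_eq (n : ℕ) :
    modPrefix n = (List.range (2 * n)).map fun i => (parQ (i + 2), i + 2) := by
  induction n with
  | zero => rfl
  | succ n ih =>
    have h1 : modPrefix (n + 1) = modPrefix n ++
      [(Quant.ex, 2 * (n + 1)), (Quant.all, 2 * (n + 1) + 1)] := by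
      simp [modPrefix, List.range_succ]
    have h2 : 2 * (n + 1) = 2 * n + 1 + 1 := by ring
    have e1 : parQ (2 * n + 2) = Quant.ex := by simp [parQ]
    have e2 : parQ (2 * n + 1 + 2) = Quant.all := by
      have : (2 * n + 1 + 2) % 2 = 1 := by omega
      simp [parQ, this]
    rw [h1, ih, h2, List.range_succ, List.range_succ]
    simp [e1, e2]

theorem modPrefix_get (n i : ℕ) (p : Quant × ℕ) :
    (modPrefix n)[i]? = some p ↔ i < 2 * n ∧ p = (parQ (i + 2), i + 2) := by
  rw [modPrefix_eq]
  rw [List.getElem?_map]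
  by_cases h : i < 2 * n
  · rw [List.getElem?_range h]; simp [h, eq_comm]
  · rw [List.getElem?_eq_none (by simpa using h)]; simp [h]

theorem mem_modPrefix (n : ℕ) (p : Quant × ℕ) :
    p ∈ modPrefix n ↔ p.1 = parQ p.2 ∧ 2 ≤ p.2 ∧ p.2 ≤ 2 * n + 1 := by
  rw [List.mem_iff_getElem?]
  simp only [modPrefix_get]
  constructor
  · rintro ⟨i, hi, rfl⟩
    refine ⟨rfl, ?_, ?_⟩ <;> simp <;> omega
  · rintro ⟨h1, h2, h3⟩
    refine ⟨p.2 - 2, by omega, ?_⟩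
    have : p.2 - 2 + 2 = p.2 := by omega
    rw [this, ← h1]

theorem preceq_mod (n u v : ℕ) :
    preceq (modPrefix n) u v ↔ 2 ≤ u ∧ u ≤ v ∧ v ≤ 2 * n + 1 := by
  constructor
  · rintro ⟨i, j, hi, hj, hij⟩
    simp only [Option.map_eq_some_iff, modPrefix_get] at hi hj
    obtain ⟨_, ⟨hi, rfl⟩, rfl⟩ := hi
    obtain ⟨_, ⟨hj, rfl⟩, rfl⟩ := hj
    simp only
    rcases hij with hij | ⟨hij, h⟩
    · omega
    · exfalso
      have h1 := h (j + 1) (by omega) (by omega)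
      rw [(modPrefix_get n (j + 1) _).2 ⟨by omega, rfl⟩,
        (modPrefix_get n j _).2 ⟨by omega, rfl⟩] at h1
      simp only [Option.map_some, Option.some.injEq, parQ] at h1
      rcases Nat.mod_two_eq_zero_or_one j with hj2 | hj2
      · have a1 : (j + 1 + 2) % 2 = 1 := by omega
        have a2 : (j + 2) % 2 = 0 := by omega
        simp [a1, a2] at h1
      · have a1 : (j + 1 + 2) % 2 = 0 := by omega
        have a2 : (j + 2) % 2 = 1 := by omega
        simp [a1, a2] at h1
  · rintro ⟨h1, h2, h3⟩
    refine ⟨u - 2, v - 2, ?_, ?_, Or.inl (by omega)⟩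
    · rw [(modPrefix_get n (u - 2) _).2 ⟨by omega, rfl⟩]; simp; omega
    · rw [(modPrefix_get n (v - 2) _).2 ⟨by omega, rfl⟩]; simp; omega

theorem strictPrec_mod (n u v : ℕ) :
    strictPrec (modPrefix n) u v ↔ 2 ≤ u ∧ u < v ∧ v ≤ 2 * n + 1 := by
  unfold strictPrec
  rw [preceq_mod, preceq_mod]
  omega

theorem inst_sorted (n : ℕ) (a : PA) :
    ((instPrefix (modPrefix n) a).map Prod.snd).Pairwise (· < ·) := by
  unfold instPrefix
  rw [List.map_map, List.pairwise_map]
  apply List.Pairwise.filter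
  rw [modPrefix_eq, List.pairwise_map]
  exact List.pairwise_lt_range.imp (by intro x y h; simpa using h)

theorem mem_inst (n : ℕ) (a : PA) (m : ℕ) (hm : a m ≠ none)
    (hmax : ∀ v, a v ≠ none → v ≤ m) (hm2 : m ≤ 2 * n + 1) (q : Quant) (v : ℕ) :
    (q, v) ∈ instPrefix (modPrefix n) a ↔
      a v = none ∧ 2 ≤ v ∧ v ≤ 2 * n + 1 ∧ q = if v < m then Quant.ex else parQ v := by
  have key : 2 ≤ v → ((∃ u, a u ≠ none ∧ strictPrec (modPrefix n) v u) ↔ v < m) := by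
    intro hv
    constructor
    · rintro ⟨u, hu, h⟩
      rw [strictPrec_mod] at h
      have := hmax u hu
      omega
    · intro h
      exact ⟨m, hm, (strictPrec_mod n v m).2 ⟨hv, h, hm2⟩⟩
  unfold instPrefix
  simp only [List.mem_map, List.mem_filter, mem_modPrefix, Prod.mk.injEq, Option.isNone_iff_eq_none]
  constructor
  · rintro ⟨⟨q', v'⟩, ⟨⟨h1, h2, h3⟩, h4⟩, h5, rfl⟩
    simp only at h1 h2 h3 h4 h5 key ⊢
    refine ⟨h4, h2, h3, ?_⟩
    rw [← h5, h1]
    simp only [key h2]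
  · rintro ⟨h1, h2, h3, h4⟩
    refine ⟨(parQ v, v), ⟨⟨rfl, h2, h3⟩, h1⟩, ?_, rfl⟩
    rw [h4]
    simp only [key h2]

theorem sum_split (f : ℕ → ℕ) (k : ℕ) :
    ∑ v ∈ Finset.Icc 2 (2 * k + 1 + 1 + 1), f v =
      ∑ v ∈ Finset.Icc 2 (2 * k + 1), f v + f (2 * k + 1 + 1) + f (2 * k + 1 + 1 + 1) := by
  have h1 := Finset.sum_Icc_succ_top (a := 2) (b := 2 * k + 1) (by omega) f
  have h2 := Finset.sum_Icc_succ_top (a := 2) (b := 2 * k + 1 + 1) (by omega) f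
  rw [h2, h1]

theorem sum_pairs (f : ℕ → ℕ) (k : ℕ) :
    ∑ i ∈ Finset.Icc 1 k, (f (2 * i) + f (2 * i + 1)) = ∑ v ∈ Finset.Icc 2 (2 * k + 1), f v := by
  induction k with
  | zero => simp
  | succ k ih =>
    rw [Finset.sum_Icc_succ_top (by omega), ih]
    have : 2 * (k + 1) = 2 * k + 1 + 1 := by ring
    rw [this, sum_split]
    ring

theorem two_bits (s r : ℕ) : ∃ c1 c2 : Bool, (s + boolVal c1 + boolVal c2) % 3 = r % 3 := by
  have h : (s % 3 = r % 3) ∨ ((s + 1) % 3 = r % 3) ∨ ((s + 2) % 3 = r % 3) := by omega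
  rcases h with h | h | h
  · exact ⟨false, false, by simpa [boolVal] using h⟩
  · exact ⟨true, false, by simpa [boolVal] using h⟩
  · exact ⟨true, true, by simpa [boolVal] using h⟩

/-- A clause with two holes is not in the axiom set. -/
theorem two_holes (n t : ℕ) (a : PA) (ha : a ∈ Hset (modQBC n) t) (u₀ h1 h2 : ℕ)
    (hu₀ : a u₀ ≠ none) (hne : h1 ≠ h2) (a1 : a h1 = none) (a2 : a h2 = none)
    (p1 : ∃ u, a u ≠ none ∧ preceq (modPrefix n) h1 u)
    (p2 : ∃ u, a u ≠ none ∧ preceq (modPrefix n) h2 u) : False := by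
  classical
  obtain ⟨hdom, Φ', ⟨hrel, hmat⟩, -, hfalse⟩ := ha
  have hdom' : ∀ v, a v ≠ none → 2 ≤ v ∧ v ≤ 2 * n + 1 := by
    intro v hv
    obtain ⟨p, hp, rfl⟩ := List.mem_map.1 (hdom v hv)
    exact ((mem_modPrefix n p).1 hp).2
  obtain ⟨m, hm, hmax⟩ : ∃ m, a m ≠ none ∧ ∀ v, a v ≠ none → v ≤ m := by
    have hS : ((Finset.range (2 * n + 2)).filter fun v => a v ≠ none).Nonempty :=
      ⟨u₀, by simp only [Finset.mem_filter, Finset.mem_range]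
              exact ⟨by have := hdom' u₀ hu₀; omega, hu₀⟩⟩
    refine ⟨_, (Finset.mem_filter.1 (Finset.max'_mem _ hS)).2, ?_⟩
    intro v hv
    apply Finset.le_max'
    simp only [Finset.mem_filter, Finset.mem_range]
    exact ⟨by have := hdom' v hv; omega, hv⟩
  have hm2 := hdom' m hm
  have hole : ∀ h, a h = none → (∃ u, a u ≠ none ∧ preceq (modPrefix n) h u) → 2 ≤ h ∧ h < m := by
    rintro h ah ⟨u, hu, hp⟩
    rw [preceq_mod] at hp
    have h3 := hmax u hu
    have : h ≠ m := by rintro rfl; exact hm ah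
    omega
  have b1 := hole h1 a1 p1
  have b2 := hole h2 a2 p2
  obtain ⟨k, hk⟩ : ∃ k, k = m / 2 := ⟨_, rfl⟩
  have hk1 : 1 ≤ k := by omega
  have hkn : k ≤ n := by omega
  obtain ⟨W, hW⟩ : ∃ W : ℕ → ℕ, W = fun v => if v ≤ m then boolVal ((a v).getD false) else 0 :=
    ⟨_, rfl⟩
  obtain ⟨c1, c2, hc⟩ := two_bits (∑ v ∈ Finset.Icc 2 (2 * k + 1), W v) (k + 1)
  let σ : ℕ → (ℕ → Bool) → Bool := fun x τ =>
    if x < m then (if x = h1 then c1 else if x = h2 then c2 else false)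
    else if x = m + 1 then true else !(τ (x - 1))
  have hmem := mem_inst n a m hm hmax hm2.2
  apply hfalse
  intro g
  have hpfx : (Ψ : QBC) → Ψ = (modQBC n).inst a → Ψ.pfx = instPrefix (modPrefix n) a := by
    rintro _ rfl; rfl
  rw [hpfx _ rfl] at hrel
  have hsort := inst_sorted n a
  refine evalQ_relaxation _ _ hrel (hsort.imp (fun h => ne_of_lt h)) σ _ ?_ ?_ g
  · intro x hx τ τ' h
    rw [hmem] at hx
    simp only [σ]
    by_cases hxm : x < m
    · simp [hxm]
    · by_cases hxm1 : x = m + 1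
      · simp [hxm1]
      · rw [if_neg hxm, if_neg hxm, if_neg hxm1, if_neg hxm1]
        have hxne : x ≠ m := by rintro rfl; exact hm hx.1
        have hpar : x % 2 = 0 := by
          by_contra hpar
          have := hx.2.2.2
          simp [hxm, parQ, hpar] at this
        have hu : (Quant.all, x - 1) ∈ instPrefix (modPrefix n) a := by
          rw [hmem]
          refine ⟨?_, by omega, by omega, ?_⟩
          · by_contra hne
            have := hmax _ hne
            omega
          · rw [if_neg (by omega)]
            have : (x - 1) % 2 = 1 := by omega
            simp [parQ, this]
        rw [h (x - 1) hu]
        have hx' : (Quant.ex, x) ∈ instPrefix (modPrefix n) a := (hmem _ _).2 hx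
        have q1 : x - 1 ∈ (instPrefix (modPrefix n) a).map Prod.snd := List.mem_map.2 ⟨_, hu, rfl⟩
        have q2 : x ∈ (instPrefix (modPrefix n) a).map Prod.snd := List.mem_map.2 ⟨_, hx', rfl⟩
        obtain ⟨i, hi, hi'⟩ := List.mem_iff_getElem.1 q1
        obtain ⟨j, hj, hj'⟩ := List.mem_iff_getElem.1 q2
        refine ⟨i, j, ?_, ?_, Or.inl ?_⟩
        · rw [← List.getElem?_map, List.getElem?_eq_getElem hi, hi']
        · rw [← List.getElem?_map, List.getElem?_eq_getElem hj, hj']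
        · by_contra hij
          have := List.pairwise_iff_getElem.1 hsort j i hj hi (by omega)
          omega
  · intro τ
    rw [hmat]
    change modMatrix n 0 (override a _)
    obtain ⟨F, hF⟩ : ∃ F : ℕ → Bool, F = override a
      (fun v => if v ∈ existVars (instPrefix (modPrefix n) a) then σ v τ else τ v) := ⟨_, rfl⟩
    rw [← hF]
    have hsome : ∀ v b, a v = some b → F v = b := by
      intro v b hv; simp [hF, override, hv]
    have hex : ∀ v, a v = none → 2 ≤ v → v ≤ 2 * n + 1 → (v < m ∨ v % 2 = 0) → F v = σ v τ := by
      intro v hv h2 h3 h4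
      have : v ∈ existVars (instPrefix (modPrefix n) a) := by
        rw [mem_existVars', hmem]
        refine ⟨hv, h2, h3, ?_⟩
        rcases h4 with h4 | h4 <;> simp [h4, parQ]
      simp [hF, override, hv, this]
    have hall : ∀ v, m < v → v % 2 = 1 → F v = τ v := by
      intro v hv h2
      have h0 : a v = none := by
        by_contra hne
        have := hmax _ hne
        omega
      have : v ∉ existVars (instPrefix (modPrefix n) a) := by
        rw [mem_existVars', hmem]
        rintro ⟨-, -, -, h⟩
        rw [if_neg (by omega)] at h
        simp [parQ, h2] at h
      simp [hF, override, h0, this]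
    -- the base of the induction
    have hbase : ∑ v ∈ Finset.Icc 2 (2 * k + 1), boolVal (F v) =
        (∑ v ∈ Finset.Icc 2 (2 * k + 1), W v) + boolVal c1 + boolVal c2 +
          (if m < 2 * k + 1 then boolVal (F (2 * k + 1)) else 0) := by
      have hpt : ∀ v ∈ Finset.Icc 2 (2 * k + 1), boolVal (F v) =
          W v + (if v = h1 then boolVal c1 else 0) + (if v = h2 then boolVal c2 else 0) +
          (if v = 2 * k + 1 then (if m < 2 * k + 1 then boolVal (F (2 * k + 1)) else 0) else 0) := by
        intro v hv
        rw [Finset.mem_Icc] at hv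
        by_cases hvm : v ≤ m
        · have z : (if v = 2 * k + 1 then
              (if m < 2 * k + 1 then boolVal (F (2 * k + 1)) else 0) else 0) = 0 := by
            split_ifs <;> omega
          rw [z, hW]
          cases hav : a v with
          | some b =>
            have n1 : v ≠ h1 := by rintro rfl; simp [hav] at a1
            have n2 : v ≠ h2 := by rintro rfl; simp [hav] at a2
            simp [hsome v b hav, hvm, n1, n2, hav]
          | none =>
            have hvm' : v < m := by
              rcases hvm.lt_or_eq with h | h
              · exact h
              · subst h; exact absurd hav hm
            rw [hex v hav hv.1 (by omega) (Or.inl hvm')]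
            simp only [σ, hvm', if_true, hvm, hav]
            by_cases e1 : v = h1
            · have e2 : v ≠ h2 := by rintro rfl; exact hne e1.symm
              simp [e1, hne, boolVal]
            · by_cases e2 : v = h2
              · simp [e2, hne.symm, boolVal]
              · simp [e1, e2, boolVal]
        · have e : v = 2 * k + 1 := by omega
          have n1 : v ≠ h1 := by omega
          have n2 : v ≠ h2 := by omega
          have hm' : m < 2 * k + 1 := by omega
          rw [hW]
          simp only [hvm, if_false, n1, n2]
          rw [if_pos e, if_pos hm', e]
          simp
      rw [Finset.sum_congr rfl hpt]
      simp only [Finset.sum_add_distrib, Finset.sum_ite_eq']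
      rw [if_pos (by rw [Finset.mem_Icc]; omega), if_pos (by rw [Finset.mem_Icc]; omega),
        if_pos (by rw [Finset.mem_Icc]; omega)]
    have hT : ∀ j, k ≤ j → j ≤ n →
        (∑ v ∈ Finset.Icc 2 (2 * j + 1), boolVal (F v)) % 3 =
          (j + 1 + (if m < 2 * j + 1 then boolVal (F (2 * j + 1)) else 0)) % 3 := by
      intro j hj
      induction j, hj using Nat.le_induction with
      | base => intro _; rw [hbase]; omega
      | succ j hj ih =>
        intro hjn
        have ih := ih (by omega)
        have e : 2 * (j + 1) + 1 = 2 * j + 1 + 1 + 1 := by ring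
        rw [e, sum_split]
        have hx : a (2 * j + 1 + 1) = none := by
          by_contra hne
          have := hmax _ hne
          omega
        rw [if_pos (by omega)]
        have hFx : boolVal (F (2 * j + 1 + 1)) +
            (if m < 2 * j + 1 then boolVal (F (2 * j + 1)) else 0) = 1 := by
          rw [hex _ hx (by omega) (by omega) (Or.inr (by omega))]
          simp only [σ]
          rw [if_neg (by omega)]
          by_cases hmj : m < 2 * j + 1
          · rw [if_neg (by omega), if_pos hmj, hall _ hmj (by omega)]
            have : 2 * j + 1 + 1 - 1 = 2 * j + 1 := by omega
            rw [this]
            cases τ (2 * j + 1) <;> simp [boolVal]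
          · rw [if_pos (by omega), if_neg hmj]
            simp [boolVal]
        omega
    have hfin := hT n hkn le_rfl
    unfold modMatrix
    rw [sum_pairs (fun v => boolVal (F v)) n]
    have hb : ∀ b, boolVal b ≤ 1 := by intro b; cases b <;> simp [boolVal]
    have := hb (F (2 * n + 1))
    split_ifs at hfin <;> omega

/-- Lemma 7.4: for `n ≥ 1` and `t ≥ 2`, in any QU-resolution
falsity proof of `Ψₙ` from `H(Ψₙ, Π_t)`, the label `f` of every sink of
`G(π)` has at most one hole, i.e. the set `{v : v ⪯ last(f)} ∖ dom(f)` has at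
most one element (`v ⪯ last(f)` being expressed as `∃ u ∈ dom f, v ⪯ u`). -/
theorem mod3_at_most_one_hole (n t : ℕ) (hn : 1 ≤ n) (ht : 2 ≤ t)
    (L : List QUStep)
    (hL : IsFalsityProof (modQBC n) (Hset (modQBC n) t) L) :
    ∀ i a, isSink L i → stepClause? L i = some a →
      {v | (∃ u, a u ≠ none ∧ preceq (modPrefix n) v u) ∧ a v = none}.Subsingleton := by
  intro i a hs ha h1 hh1 h2 hh2
  by_contra hne
  obtain ⟨hlt, hedge⟩ := hs
  have hv := hL.1 i
  obtain ⟨st, hst, hcl⟩ := Option.map_eq_some_iff.1 ha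
  have hax : a ∈ Hset (modQBC n) t := by
    cases st with
    | ax C =>
      simp only [validStep, hst] at hv
      rw [← hcl]
      exact hv
    | elim C s => exact absurd (by simp [edge, hst]) (hedge s)
    | res C s s' v => exact absurd (by simp [edge, hst]) (hedge s)
  obtain ⟨⟨u, hu, hp⟩, n1⟩ := hh1
  exact two_holes n t a hax u h1 h2 hu hne n1 hh2.2 ⟨u, hu, hp⟩ hh2.1
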